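/- Fix α, δ ∈ ℝ, γ_L, γ_U > 0 with γ_L > γ_U(cosh(2δ) − 1), and r > 0. Let K₃ = [[cosh(δ)·I₂, sinh(δ)·η₂],[sinh(δ)·η₂, cosh(δ)·I₂]] be the amplifier symplectic matrix, let A = ½[[cosh(2α)·I₂, −sinh(2α)·η₂],[−sinh(2α)·η₂, cosh(2α)·I₂]], and let the mixed dissipator be D(V) = γ_L·(J(J/2)V + V(J/2)J − JAJ) + γ_U·(K₃ V K₃ᵀ − V). Let V(ν₁,ν₂,r) be the 4×4 squeezed-thermal covariance matrix in standard form with ν₁, ν₂ ≥ 1/2. Then there exists a real symmetric 4×4 matrix G with JGV − VGJ + D(V) = 0 if and only if ν₁ = ν₂ = γ_L·cosh(2(r−α)) / (2(γ_L − γ_U(cosh(2δ) − 1))). -/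

import Mathlib

open Matrix

noncomputable def J4 : Matrix (Fin 4) (Fin 4) ℝ :=
  !![0, 1, 0, 0; -1, 0, 0, 0; 0, 0, 0, 1; 0, 0, -1, 0]

noncomputable def Vsf (ν₁ ν₂ r : ℝ) : Matrix (Fin 4) (Fin 4) ℝ :=
  !![ν₁ * Real.cosh r ^ 2 + ν₂ * Real.sinh r ^ 2, 0,
       (ν₁ + ν₂) / 2 * Real.sinh (2*r), 0;
     0, ν₁ * Real.cosh r ^ 2 + ν₂ * Real.sinh r ^ 2, 0,
       -((ν₁ + ν₂) / 2 * Real.sinh (2*r));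
     (ν₁ + ν₂) / 2 * Real.sinh (2*r), 0,
       ν₁ * Real.sinh r ^ 2 + ν₂ * Real.cosh r ^ 2, 0;
     0, -((ν₁ + ν₂) / 2 * Real.sinh (2*r)), 0,
       ν₁ * Real.sinh r ^ 2 + ν₂ * Real.cosh r ^ 2]

noncomputable def Aeng (α : ℝ) : Matrix (Fin 4) (Fin 4) ℝ :=
  (1/2 : ℝ) •
    !![Real.cosh (2*α), 0, -Real.sinh (2*α), 0;
       0, Real.cosh (2*α), 0, Real.sinh (2*α);
       -Real.sinh (2*α), 0, Real.cosh (2*α), 0;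
       0, Real.sinh (2*α), 0, Real.cosh (2*α)]

noncomputable def Kamp (δ : ℝ) : Matrix (Fin 4) (Fin 4) ℝ :=
  !![Real.cosh δ, 0, Real.sinh δ, 0;
     0, Real.cosh δ, 0, -Real.sinh δ;
     Real.sinh δ, 0, Real.cosh δ, 0;
     0, -Real.sinh δ, 0, Real.cosh δ]

/-- Covariance matrices in standard form with opposite correlations `c` and `-c`. -/
def standardForm (a b c : ℝ) : Matrix (Fin 4) (Fin 4) ℝ :=
  !![a, 0, c, 0; 0, a, 0, -c; c, 0, b, 0; 0, -c, 0, b]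

theorem standardForm_add (a b c a' b' c' : ℝ) :
    standardForm a b c + standardForm a' b' c' = standardForm (a + a') (b + b') (c + c') := by
  ext i j
  fin_cases i <;> fin_cases j <;> simp [standardForm] <;> ring

theorem smul_standardForm (t a b c : ℝ) :
    t • standardForm a b c = standardForm (t * a) (t * b) (t * c) := by
  ext i j
  fin_cases i <;> fin_cases j <;> simp [standardForm]

theorem Vsf_eq_standardForm (ν₁ ν₂ r : ℝ) :
    Vsf ν₁ ν₂ r = standardForm (ν₁ * Real.cosh r ^ 2 + ν₂ * Real.sinh r ^ 2)
      (ν₁ * Real.sinh r ^ 2 + ν₂ * Real.cosh r ^ 2) ((ν₁ + ν₂) / 2 * Real.sinh (2 * r)) :=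
  rfl

theorem linear_dissipator_standardForm (α a b c : ℝ) :
    J4 * ((1/2 : ℝ) • J4) * standardForm a b c + standardForm a b c * ((1/2 : ℝ) • J4) * J4
      - J4 * Aeng α * J4 =
    standardForm (Real.cosh (2 * α) / 2 - a) (Real.cosh (2 * α) / 2 - b)
      (Real.sinh (2 * α) / 2 - c) := by
  ext i j
  fin_cases i <;> fin_cases j <;>
    simp [-Matrix.cons_mul, standardForm, J4, Aeng, Matrix.mul_apply, Fin.sum_univ_four] <;> ring

theorem unitary_dissipator_standardForm (δ a b c : ℝ) :
    Kamp δ * standardForm a b c * (Kamp δ)ᵀ - standardForm a b c =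
    standardForm
      (Real.cosh δ ^ 2 * a + 2 * Real.cosh δ * Real.sinh δ * c + Real.sinh δ ^ 2 * b - a)
      (Real.sinh δ ^ 2 * a + 2 * Real.cosh δ * Real.sinh δ * c + Real.cosh δ ^ 2 * b - b)
      (Real.cosh δ * Real.sinh δ * (a + b) + (Real.cosh δ ^ 2 + Real.sinh δ ^ 2) * c - c) := by
  ext i j
  fin_cases i <;> fin_cases j <;>
    simp [-Matrix.cons_mul, standardForm, Kamp, Matrix.mul_apply, Fin.sum_univ_four] <;> ring

/-- Pairing a Hamiltonian drift with `J V J` and with the adjugate of `V` gives zero. -/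
theorem drift_constraints {a b c x y z : ℝ} {G : Matrix (Fin 4) (Fin 4) ℝ} (hG : Gᵀ = G)
    (h : J4 * G * standardForm a b c - standardForm a b c * G * J4 + standardForm x y z = 0) :
    a * x + b * y - 2 * c * z = 0 ∧ b * x + a * y - 2 * c * z = 0 := by
  have hs (i j : Fin 4) : G i j = G j i := congrFun (congrFun hG j) i
  have h00 := congrFun (congrFun h 0) 0
  have h11 := congrFun (congrFun h 1) 1
  have h22 := congrFun (congrFun h 2) 2
  have h33 := congrFun (congrFun h 3) 3
  have h02 := congrFun (congrFun h 0) 2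
  have h13 := congrFun (congrFun h 1) 3
  simp [-Matrix.cons_mul, standardForm, J4, Matrix.mul_apply, Fin.sum_univ_four,
    hs 1 0, hs 2 0, hs 3 0, hs 2 1, hs 3 1, hs 3 2] at h00 h11 h22 h33 h02 h13
  constructor
  · linear_combination (a * (h00 + h11) + b * (h22 + h33) - 2 * c * (h02 - h13)) / 2
  · linear_combination (b * (h00 + h11) + a * (h22 + h33) - 2 * c * (h02 - h13)) / 2

/-- The two-mode squeezing Hamiltonian compensates a symmetric dissipator tangent to the orbit. -/
theorem exists_drift {a c x z : ℝ} (ha : a ≠ 0) (h : a * x = c * z) :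
    ∃ G : Matrix (Fin 4) (Fin 4) ℝ, Gᵀ = G ∧
      J4 * G * standardForm a a c - standardForm a a c * G * J4 + standardForm x x z = 0 := by
  obtain ⟨g, hz⟩ : ∃ g, z = -(2 * a * g) := ⟨-z / (2 * a), by field_simp⟩
  have hx : x = -(2 * c * g) := by
    apply mul_left_cancel₀ ha
    rw [h, hz]
    ring
  refine ⟨!![0, 0, 0, g; 0, 0, g, 0; 0, g, 0, 0; g, 0, 0, 0], ?_, ?_⟩
  · ext i j
    fin_cases i <;> fin_cases j <;> rfl
  · subst hx hz
    ext i j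
    fin_cases i <;> fin_cases j <;>
      simp [-Matrix.cons_mul, standardForm, J4, Matrix.mul_apply, Fin.sum_univ_four] <;> ring

/-- The tangency defect of the mixed dissipator at a symmetric squeezed thermal state. -/
theorem tangency_defect (α δ γL γU r ν : ℝ) :
    Real.cosh (2 * r) * (γL * (Real.cosh (2 * α) / 2 - ν * Real.cosh (2 * r)) +
        γU * (Real.cosh δ ^ 2 * (ν * Real.cosh (2 * r)) +
          2 * Real.cosh δ * Real.sinh δ * (ν * Real.sinh (2 * r)) +
          Real.sinh δ ^ 2 * (ν * Real.cosh (2 * r)) - ν * Real.cosh (2 * r))) -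
      Real.sinh (2 * r) * (γL * (Real.sinh (2 * α) / 2 - ν * Real.sinh (2 * r)) +
        γU * (Real.cosh δ * Real.sinh δ * (ν * Real.cosh (2 * r) + ν * Real.cosh (2 * r)) +
          (Real.cosh δ ^ 2 + Real.sinh δ ^ 2) * (ν * Real.sinh (2 * r)) -
          ν * Real.sinh (2 * r))) =
    γL * Real.cosh (2 * (r - α)) / 2 - ν * (γL - γU * (Real.cosh (2 * δ) - 1)) := by
  rw [mul_sub 2 r α, Real.cosh_sub, Real.cosh_two_mul δ]
  linear_combination (ν * (γU * (Real.cosh δ ^ 2 + Real.sinh δ ^ 2 - 1) - γL)) *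
    Real.cosh_sq_sub_sinh_sq (2 * r)

theorem stmt_19 (α δ : ℝ) (γL γU : ℝ) (hγL : 0 < γL) (hγU : 0 < γU)
    (hdom : γU * (Real.cosh (2*δ) - 1) < γL)
    (r : ℝ) (hr : 0 < r)
    (ν₁ ν₂ : ℝ) (h1 : 1/2 ≤ ν₁) (h2 : 1/2 ≤ ν₂) :
    (∃ G : Matrix (Fin 4) (Fin 4) ℝ, Gᵀ = G ∧
        J4 * G * Vsf ν₁ ν₂ r - Vsf ν₁ ν₂ r * G * J4
          + (γL • (J4 * ((1/2 : ℝ) • J4) * Vsf ν₁ ν₂ r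
              + Vsf ν₁ ν₂ r * ((1/2 : ℝ) • J4) * J4
              - J4 * Aeng α * J4)
            + γU • (Kamp δ * Vsf ν₁ ν₂ r * (Kamp δ)ᵀ - Vsf ν₁ ν₂ r)) = 0) ↔
    (ν₁ = γL * Real.cosh (2*(r - α)) / (2 * (γL - γU * (Real.cosh (2*δ) - 1))) ∧
     ν₂ = γL * Real.cosh (2*(r - α)) / (2 * (γL - γU * (Real.cosh (2*δ) - 1)))) := by
  have hD : 0 < γL - γU * (Real.cosh (2 * δ) - 1) := sub_pos.2 hdom
  have hC : 0 < Real.cosh (2 * r) := Real.cosh_pos _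
  have hr2 := Real.cosh_two_mul r
  have hδ := Real.cosh_sq_sub_sinh_sq δ
  simp only [Vsf_eq_standardForm, linear_dissipator_standardForm,
    unitary_dissipator_standardForm, smul_standardForm, standardForm_add]
  have hdiag (ν : ℝ) : ν * Real.cosh r ^ 2 + ν * Real.sinh r ^ 2 = ν * Real.cosh (2 * r) := by
    rw [hr2]; ring
  have hdiag' (ν : ℝ) : ν * Real.sinh r ^ 2 + ν * Real.cosh r ^ 2 = ν * Real.cosh (2 * r) := by
    rw [hr2]; ring
  have hoff (ν : ℝ) : (ν + ν) / 2 * Real.sinh (2 * r) = ν * Real.sinh (2 * r) := by ring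
  constructor
  · rintro ⟨G, hG, h⟩
    obtain ⟨hV, hadj⟩ := drift_constraints hG h
    have hν : ν₁ = ν₂ := by
      have hsq : γL * (ν₁ - ν₂) ^ 2 = 0 := by
        have hr1 := Real.cosh_sq_sub_sinh_sq r
        rw [sub_eq_iff_eq_add] at hr1 hδ
        rw [hr1, hδ] at hV hadj
        linear_combination hadj - hV
      exact sub_eq_zero.1 (pow_eq_zero_iff two_ne_zero |>.1
        ((mul_eq_zero.1 hsq).resolve_left hγL.ne'))
    subst hν
    rw [hdiag, hdiag', hoff] at hV
    have hdef : ν₁ * (γL * Real.cosh (2 * (r - α)) / 2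
        - ν₁ * (γL - γU * (Real.cosh (2 * δ) - 1))) = 0 := by
      rw [← tangency_defect]
      linear_combination hV / 2
    have hval := (mul_eq_zero.1 hdef).resolve_left (by linarith)
    rw [and_self, eq_div_iff (by positivity)]
    linear_combination -2 * hval
  · rintro ⟨h₁, h₂⟩
    obtain rfl : ν₁ = ν₂ := h₁.trans h₂.symm
    rw [eq_div_iff (by positivity)] at h₁
    have hval := tangency_defect α δ γL γU r ν₁
    rw [hdiag, hdiag', hoff]
    rw [show Real.sinh δ ^ 2 * (ν₁ * Real.cosh (2 * r)) +
        2 * Real.cosh δ * Real.sinh δ * (ν₁ * Real.sinh (2 * r)) +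
        Real.cosh δ ^ 2 * (ν₁ * Real.cosh (2 * r)) =
      Real.cosh δ ^ 2 * (ν₁ * Real.cosh (2 * r)) +
        2 * Real.cosh δ * Real.sinh δ * (ν₁ * Real.sinh (2 * r)) +
        Real.sinh δ ^ 2 * (ν₁ * Real.cosh (2 * r)) by ring]
    have hν : 0 < ν₁ := by linarith
    refine exists_drift (by positivity) ?_
    linear_combination ν₁ * hval - ν₁ / 2 * h₁
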